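/- (Estimate (4.9): uniform lower bound on the nodal set) Assume (h1), (h2), (h3) and let f satisfy (f1) and (f2). Then there exists β > 0 such that ‖v⁺‖ ≥ β and ‖v⁻‖ ≥ β for every v ∈ M. -/

import Mathlib

open MeasureTheory Filter

noncomputable section

namespace ZeroMass

/-- The ambient Euclidean space `ℝ^N`. -/
abbrev EN (N : ℕ) := EuclideanSpace ℝ (Fin N)

/-- The critical fractional Sobolev exponent `2*_α = 2N/(N-2α)`. -/
def critExp (N : ℕ) (α : ℝ) : ℝ := 2 * N / (N - 2 * α)

/-- The square of the Gagliardo seminorm `[u]²`. -/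
def gagSq (N : ℕ) (α : ℝ) (u : EN N → ℝ) : ENNReal :=
  ∫⁻ p : EN N × EN N, ENNReal.ofReal ((u p.1 - u p.2) ^ 2 / ‖p.1 - p.2‖ ^ ((N : ℝ) + 2 * α))

/-- The square of the full norm `‖u‖² = [u]² + ∫ V u²`. -/
def normSq {N : ℕ} (α : ℝ) (V : EN N → ℝ) (u : EN N → ℝ) : ENNReal :=
  gagSq N α u + ∫⁻ x, ENNReal.ofReal (V x * u x ^ 2)

/-- Membership in the space `X`. -/
def memX {N : ℕ} (α : ℝ) (V : EN N → ℝ) (u : EN N → ℝ) : Prop :=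
  Measurable u ∧ normSq α V u < ⊤

/-- The norm of `X`, i.e. `‖u‖ = ([u]² + ∫ V u²)^{1/2}`. -/
def Xnorm {N : ℕ} (α : ℝ) (V : EN N → ℝ) (u : EN N → ℝ) : ℝ :=
  ((normSq α V u).toReal) ^ (1 / 2 : ℝ)

/-- The primitive `F(t) = ∫₀ᵗ f(τ) dτ`. -/
def prim (f : ℝ → ℝ) (t : ℝ) : ℝ := ∫ τ in (0 : ℝ)..t, f τ

/-- The energy functional `J`. -/
def Jfun {N : ℕ} (α : ℝ) (V K : EN N → ℝ) (f : ℝ → ℝ) (u : EN N → ℝ) : ℝ :=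
  (1 / 2) * (normSq α V u).toReal - ∫ x, K x * prim f (u x)

/-- The pairing `⟨J'(u), φ⟩`. -/
def Jd {N : ℕ} (α : ℝ) (V K : EN N → ℝ) (f : ℝ → ℝ) (u φ : EN N → ℝ) : ℝ :=
  (∫ p : EN N × EN N, (u p.1 - u p.2) * (φ p.1 - φ p.2) / ‖p.1 - p.2‖ ^ ((N : ℝ) + 2 * α))
    + (∫ x, V x * u x * φ x) - ∫ x, K x * f (u x) * φ x

/-- Positive part `u⁺ = max(u, 0)`. -/
def uplus {N : ℕ} (u : EN N → ℝ) : EN N → ℝ := fun x => max (u x) 0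

/-- Negative part `u⁻ = min(u, 0)`. -/
def uminus {N : ℕ} (u : EN N → ℝ) : EN N → ℝ := fun x => min (u x) 0

/-- `u` is not almost everywhere zero. -/
def NotAEZero {N : ℕ} (u : EN N → ℝ) : Prop :=
  ¬ (u =ᵐ[(volume : Measure (EN N))] (0 : EN N → ℝ))

/-- Hypothesis (h1): `V, K > 0` everywhere and `K` bounded. -/
def H1 {N : ℕ} (V K : EN N → ℝ) : Prop :=
  (∀ x, 0 < V x) ∧ (∀ x, 0 < K x) ∧ ∃ C : ℝ, ∀ x, K x ≤ C

/-- Hypothesis (h2): uniform vanishing of `∫_{A_n ∩ {|x| ≥ r}} K`. -/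
def H2 {N : ℕ} (K : EN N → ℝ) : Prop :=
  ∀ (A : ℕ → Set (EN N)) (R : ℝ), 0 < R → (∀ n, MeasurableSet (A n)) →
    (∀ n, volume (A n) ≤ ENNReal.ofReal R) →
    ∀ ε : ℝ, 0 < ε → ∃ r₀ : ℝ, ∀ r : ℝ, r₀ ≤ r → ∀ n,
      (∫⁻ x in A n ∩ {x : EN N | r ≤ ‖x‖}, ENNReal.ofReal (K x)) ≤ ENNReal.ofReal ε

/-- Hypothesis (h3): `K/V` is bounded. -/
def H3 {N : ℕ} (V K : EN N → ℝ) : Prop := ∃ C : ℝ, ∀ x, K x / V x ≤ C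

/-- Hypothesis (h4) with exponent `m`. -/
def H4 {N : ℕ} (α : ℝ) (V K : EN N → ℝ) (m : ℝ) : Prop :=
  2 < m ∧ m < critExp N α ∧
    Tendsto (fun x : EN N => K x / V x ^ ((critExp N α - m) / (critExp N α - 2)))
      (comap (fun x : EN N => ‖x‖) atTop) (nhds 0)

/-- Hypothesis (f1): `f(t)/|t| → 0` as `t → 0`. -/
def Cf1 (f : ℝ → ℝ) : Prop :=
  Tendsto (fun t : ℝ => f t / |t|) (nhdsWithin 0 {(0 : ℝ)}ᶜ) (nhds 0)

/-- Hypothesis (f̃1): `limsup_{t→0} f(t)/|t|^{m-1} < ∞`. -/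
def Cf1' (f : ℝ → ℝ) (m : ℝ) : Prop :=
  ∃ C : ℝ, ∀ᶠ t in nhdsWithin (0 : ℝ) {(0 : ℝ)}ᶜ, f t / |t| ^ (m - 1) ≤ C

/-- Hypothesis (f2) with exponent `p`: `f(t)/|t|^{p-1} → 0` as `|t| → ∞`. -/
def Cf2 (f : ℝ → ℝ) (p : ℝ) : Prop :=
  Tendsto (fun t : ℝ => f t / |t| ^ (p - 1)) (comap (fun t : ℝ => |t|) atTop) (nhds 0)

/-- Hypothesis (f3): `F(t)/t² → +∞` as `|t| → ∞`. -/
def Cf3 (f : ℝ → ℝ) : Prop :=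
  Tendsto (fun t : ℝ => prim f t / t ^ 2) (comap (fun t : ℝ => |t|) atTop) atTop

/-- Hypothesis (f4): `t ↦ f(t)/|t|` is strictly increasing on `ℝ \ {0}`. -/
def Cf4 (f : ℝ → ℝ) : Prop :=
  ∀ s t : ℝ, s ≠ 0 → t ≠ 0 → s < t → f s / |s| < f t / |t|

/-- Nehari manifold membership, formulated with the pairing `⟨J'(u), u⟩ = 0`. -/
def memNehari {N : ℕ} (α : ℝ) (V K : EN N → ℝ) (f : ℝ → ℝ) (u : EN N → ℝ) : Prop :=
  memX α V u ∧ NotAEZero u ∧ Jd α V K f u u = 0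

/-- Nehari manifold membership, formulated as `‖u‖² = ∫ K f(u) u`. -/
def memNehari2 {N : ℕ} (α : ℝ) (V K : EN N → ℝ) (f : ℝ → ℝ) (u : EN N → ℝ) : Prop :=
  memX α V u ∧ NotAEZero u ∧ (normSq α V u).toReal = ∫ x, K x * f (u x) * u x

/-- Nodal (sign-changing) Nehari set membership. -/
def memM {N : ℕ} (α : ℝ) (V K : EN N → ℝ) (f : ℝ → ℝ) (u : EN N → ℝ) : Prop :=
  memNehari α V K f u ∧ NotAEZero (uplus u) ∧ NotAEZero (uminus u) ∧
    Jd α V K f u (uplus u) = 0 ∧ Jd α V K f u (uminus u) = 0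

/-- Weak convergence in `X` of the sequence `u` to `w`. -/
def weakConv {N : ℕ} (α : ℝ) (V : EN N → ℝ) (u : ℕ → EN N → ℝ) (w : EN N → ℝ) : Prop :=
  ∀ v : EN N → ℝ, memX α V v →
    Tendsto (fun n =>
      (∫ p : EN N × EN N,
        ((u n p.1 - w p.1) - (u n p.2 - w p.2)) * (v p.1 - v p.2)
          / ‖p.1 - p.2‖ ^ ((N : ℝ) + 2 * α))
      + ∫ x, V x * (u n x - w x) * v x) atTop (nhds 0)

end ZeroMass

namespace ZeroMass

variable {N : ℕ} {α : ℝ}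

lemma critExp_gt_two (hα : 0 < α) (hN : 2 * α < N) : 2 < critExp N α := by
  unfold critExp
  rw [lt_div_iff₀ (by linarith)]
  linarith

lemma critExp_sub_two_div (hα : 0 < α) (hN : 2 * α < N) :
    (critExp N α - 2) / critExp N α = 2 * α / N := by
  have h1 : (N : ℝ) - 2 * α ≠ 0 := by linarith
  have h2 : (N : ℝ) ≠ 0 := by linarith
  unfold critExp
  field_simp
  ring

lemma critExp_mul_two_mul_div (hα : 0 < α) (hN : 2 * α < N) :
    critExp N α * (2 * α / N) = critExp N α - 2 := by
  have := critExp_gt_two hα hN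
  rw [← critExp_sub_two_div hα hN]
  field_simp

/-- The Lebesgue measure of the unit ball, as a real number. -/
def unitVol (N : ℕ) : ℝ := (volume (Metric.ball (0 : EN N) 1)).toReal

lemma unitVol_pos : 0 < unitVol N :=
  ENNReal.toReal_pos (Metric.measure_ball_pos _ _ one_pos).ne' measure_ball_lt_top.ne

lemma volume_ball_eq (hN : 0 < N) (x : EN N) {r : ℝ} (hr : 0 ≤ r) :
    volume (Metric.ball x r) = ENNReal.ofReal (unitVol N * r ^ N) := by
  have : Nonempty (Fin N) := ⟨⟨0, hN⟩⟩
  rw [Measure.addHaar_ball _ _ hr, finrank_euclideanSpace_fin, mul_comm (unitVol N),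
    ENNReal.ofReal_mul (by positivity), unitVol, ENNReal.ofReal_toReal measure_ball_lt_top.ne]

/-- A point `x` of the ball of radius `R` sees a ball of any radius `ρ ≤ R` inside it,
contained in the ball of radius `2ρ` about `x`. -/
lemma exists_ball_subset {R ρ : ℝ} (hρ : 0 < ρ) (hρR : ρ ≤ R) {x : EN N}
    (hx : x ∈ Metric.ball (0 : EN N) R) :
    ∃ z, Metric.ball z ρ ⊆ Metric.ball (0 : EN N) R ∧
      Metric.ball z ρ ⊆ Metric.ball x (2 * ρ) := by
  have hR : 0 < R := hρ.trans_le hρR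
  have hxR : ‖x‖ < R := by simpa using hx
  have ht0 : 0 < ρ / R := by positivity
  have ht1 : ρ / R ≤ 1 := (div_le_one hR).2 hρR
  have hmul : ρ / R * R = ρ := by field_simp
  refine ⟨(1 - ρ / R) • x, Metric.ball_subset_ball' ?_, Metric.ball_subset_ball' ?_⟩
  · rw [dist_zero_right, norm_smul, Real.norm_of_nonneg (by linarith)]
    nlinarith
  · rw [dist_eq_norm, show (1 - ρ / R) • x - x = -((ρ / R) • x) by rw [sub_smul, one_smul]; abel,
      norm_neg, norm_smul, Real.norm_of_nonneg ht0.le]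
    nlinarith

/-- The kernel of the Gagliardo seminorm. -/
def gagKer (α : ℝ) (w : EN N → ℝ) (x y : EN N) : ENNReal :=
  ENNReal.ofReal ((w x - w y) ^ 2 / ‖x - y‖ ^ ((N : ℝ) + 2 * α))

lemma measurable_gagKer {w : EN N → ℝ} (hw : Measurable w) :
    Measurable (fun p : EN N × EN N => gagKer α w p.1 p.2) := by
  unfold gagKer
  fun_prop

/-- If `w` oscillates by at least `d` between `x` and the points of a set `A` within distance
`r` of `x`, the kernel has a large integral over `A`. -/
lemma le_setLIntegral_gagKer (hα : 0 < α) (w : EN N → ℝ) {x : EN N} {r d : ℝ}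
    (hd : 0 < d) {A : Set (EN N)} (hA : MeasurableSet A)
    (hAr : A ⊆ Metric.ball x r) (hAd : ∀ y ∈ A, d ≤ |w x - w y|) :
    ENNReal.ofReal (d ^ 2 / r ^ ((N : ℝ) + 2 * α)) * volume A ≤ ∫⁻ y in A, gagKer α w x y := by
  rw [← setLIntegral_const]
  refine setLIntegral_mono' hA fun y hy => ENNReal.ofReal_le_ofReal ?_
  have hyr : ‖x - y‖ < r := by
    rw [← dist_eq_norm, dist_comm]; exact hAr hy
  have hxy : 0 < ‖x - y‖ := by
    rw [norm_pos_iff, sub_ne_zero]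
    rintro rfl
    have := hAd x hy
    simp at this
    linarith
  have h2 : d ^ 2 ≤ (w x - w y) ^ 2 := by
    rw [← sq_abs (w x - w y)]
    have := hAd y hy
    gcongr
  gcongr

/-- At a point where `|w| = t`, the Gagliardo kernel is bounded below in terms of `t` and of
the `L^q` norm of `w` on a ball on which `w` has zero mean. -/
lemma rpow_le_mul_setLIntegral_gagKer (hα : 0 < α) (hN : 2 * α < N) :
    ∃ C : ℝ, 0 < C ∧ ∀ (R I : ℝ) (w : EN N → ℝ), 0 < R → 0 < I → Measurable w →
      (∫⁻ y in Metric.ball 0 R, ENNReal.ofReal (|w y| ^ critExp N α)) ≤ ENNReal.ofReal I →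
      ∀ x ∈ Metric.ball (0 : EN N) R,
        (ENNReal.ofReal (w x ^ 2) * volume (Metric.ball (0 : EN N) R) ≤
          ∫⁻ y in Metric.ball 0 R, ENNReal.ofReal ((w x - w y) ^ 2)) →
        ENNReal.ofReal (|w x| ^ critExp N α) ≤
          ENNReal.ofReal (C * I ^ (2 * α / N)) * ∫⁻ y in Metric.ball 0 R, gagKer α w x y := by
  have hNpos : (0 : ℝ) < N := by linarith
  have hN0 : 0 < N := by exact_mod_cast hNpos
  have hq := critExp_gt_two hα hN
  have hqe := critExp_mul_two_mul_div hα hN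
  set q := critExp N α with hqdef
  have hω : 0 < unitVol N := unitVol_pos
  set ω := unitVol N
  set s : ℝ := (N : ℝ) + 2 * α with hs
  set c : ℝ := ω / (2 ^ s * 8) with hc
  have hcpos : 0 < c := by positivity
  set b : ℝ := 2 ^ (q + 1) / ω with hb
  have hbpos : 0 < b := by positivity
  refine ⟨b ^ (2 * α / N) / c, by positivity, fun R I w hR hI hw hwI x hx hmean => ?_⟩
  rcases eq_or_ne (w x) 0 with h0 | h0
  · rw [h0, abs_zero, Real.zero_rpow (by linarith)]
    simp
  set t := |w x| with ht
  have htpos : 0 < t := abs_pos.2 h0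
  set ρ : ℝ := (b * I / t ^ q) ^ (1 / (N : ℝ)) with hρ
  have hρpos : 0 < ρ := by positivity
  have hρN : ρ ^ N = b * I / t ^ q := by
    rw [hρ, ← Real.rpow_natCast, ← Real.rpow_mul (by positivity), one_div_mul_cancel hNpos.ne',
      Real.rpow_one]
  have hρs : ∀ r : ℝ, 0 < r → r ^ N / r ^ s = r ^ (-(2 * α)) := fun r hr => by
    rw [← Real.rpow_natCast, ← Real.rpow_sub hr, hs]
    congr 1; ring
  have hval : t ^ 2 * ρ ^ (-(2 * α)) = t ^ q / (b ^ (2 * α / N) * I ^ (2 * α / N)) := by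
    have e1 : ρ ^ (-(2 * α)) = ((b * I / t ^ q) ^ (2 * α / N))⁻¹ := by
      rw [hρ, ← Real.rpow_mul (by positivity), ← Real.rpow_neg (by positivity)]
      congr 1; ring
    rw [e1, Real.div_rpow (by positivity) (by positivity), ← Real.rpow_mul htpos.le, hqe,
      Real.mul_rpow (by positivity) (by positivity), Real.rpow_sub htpos,
      Real.rpow_two]
    field_simp
  have key : ENNReal.ofReal (c * (t ^ 2 * ρ ^ (-(2 * α)))) ≤
      ∫⁻ y in Metric.ball 0 R, gagKer α w x y := by
    rcases le_or_gt ρ R with hle | hlt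
    · obtain ⟨z, hz1, hz2⟩ := exists_ball_subset hρpos hle hx
      set D : Set (EN N) := {y | t / 2 ≤ |w y|} with hD
      have hDm : MeasurableSet D := measurableSet_le measurable_const hw.abs
      have hA : MeasurableSet (Metric.ball z ρ \ D) := measurableSet_ball.diff hDm
      have hbad : volume (Metric.ball z ρ ∩ D) ≤ ENNReal.ofReal (ω * ρ ^ N / 2) := by
        have h1 : ENNReal.ofReal ((t / 2) ^ q) * volume (Metric.ball z ρ ∩ D) ≤
            ENNReal.ofReal I := by
          rw [← setLIntegral_const]
          refine le_trans ?_ ((lintegral_mono_set hz1).trans hwI)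
          refine le_trans ?_ (lintegral_mono_set (Set.inter_subset_left (t := D)))
          refine setLIntegral_mono' (measurableSet_ball.inter hDm) fun y hy =>
            ENNReal.ofReal_le_ofReal ?_
          have : t / 2 ≤ |w y| := hy.2
          gcongr
        have h2 : ENNReal.ofReal (ω * ρ ^ N / 2) =
            ENNReal.ofReal I / ENNReal.ofReal ((t / 2) ^ q) := by
          rw [← ENNReal.ofReal_div_of_pos (by positivity), hρN, hb]
          congr 1
          rw [Real.div_rpow htpos.le zero_le_two, Real.rpow_add_one two_ne_zero]
          field_simp
        rw [h2, ENNReal.le_div_iff_mul_le (Or.inl (by positivity)) (Or.inl ENNReal.ofReal_ne_top),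
          mul_comm]
        exact h1
      have hvol : ENNReal.ofReal (ω * ρ ^ N / 2) ≤ volume (Metric.ball z ρ \ D) := by
        rw [← Set.sdiff_inter_self_eq_sdiff, Set.inter_comm]
        refine le_trans ?_ le_measure_sdiff
        rw [volume_ball_eq hN0 _ hρpos.le]
        calc ENNReal.ofReal (ω * ρ ^ N / 2)
            = ENNReal.ofReal (ω * ρ ^ N) - ENNReal.ofReal (ω * ρ ^ N / 2) := by
              rw [← ENNReal.ofReal_sub _ (by positivity)]; congr 1; ring
          _ ≤ _ := tsub_le_tsub_left hbad _
      have hG := le_setLIntegral_gagKer hα w (x := x) (r := 2 * ρ) (half_pos htpos) hA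
        (Set.sdiff_subset.trans hz2) (fun y hy => by
          have h1 : |w y| < t / 2 := not_le.1 hy.2
          have h2 := abs_sub_abs_le_abs_sub (w x) (w y)
          linarith)
      refine le_trans ?_ (hG.trans (lintegral_mono_set (Set.sdiff_subset.trans hz1)))
      refine le_trans ?_ (mul_le_mul_right hvol _)
      rw [← ENNReal.ofReal_mul (by positivity), ← hρs ρ hρpos, Real.mul_rpow two_pos.le hρpos.le]
      refine ENNReal.ofReal_le_ofReal (le_of_eq ?_)
      rw [hc]
      field_simp
      norm_num
      rw [← hs]
      ring
    · have h1 : ∫⁻ y in Metric.ball 0 R, ENNReal.ofReal (((2 * R) ^ s)⁻¹) *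
            ENNReal.ofReal ((w x - w y) ^ 2) ≤ ∫⁻ y in Metric.ball 0 R, gagKer α w x y := by
        refine setLIntegral_mono' measurableSet_ball fun y hy => ?_
        rw [← ENNReal.ofReal_mul (by positivity)]
        refine ENNReal.ofReal_le_ofReal ?_
        rcases eq_or_ne x y with rfl | hxy
        · simp
        have hxy' : 0 < ‖x - y‖ := norm_pos_iff.2 (sub_ne_zero.2 hxy)
        have hle : ‖x - y‖ ≤ 2 * R := by
          have h1 : ‖x‖ < R := by simpa using hx
          have h2 : ‖y‖ < R := by simpa using hy
          linarith [norm_sub_le x y]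
        rw [mul_comm, ← div_eq_mul_inv]
        gcongr
      rw [lintegral_const_mul _ (by fun_prop)] at h1
      refine le_trans ?_ h1
      refine le_trans ?_ (mul_le_mul_right hmean _)
      rw [volume_ball_eq hN0 _ hR.le, ← ENNReal.ofReal_mul (by positivity),
        ← ENNReal.ofReal_mul (by positivity), ← sq_abs (w x), ← ht]
      refine ENNReal.ofReal_le_ofReal ?_
      have h2 : ρ ^ (-(2 * α)) ≤ R ^ (-(2 * α)) :=
        Real.rpow_le_rpow_of_nonpos hR hlt.le (by linarith)
      calc c * (t ^ 2 * ρ ^ (-(2 * α))) ≤ (ω / 2 ^ s) * (t ^ 2 * R ^ (-(2 * α))) := by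
            have : c ≤ ω / 2 ^ s := by
              rw [hc, ← div_div]
              have : 0 < ω / 2 ^ s := by positivity
              linarith
            gcongr
        _ = _ := by
            rw [← hρs R hR, Real.mul_rpow two_pos.le hR.le]
            field_simp
            rfl
  calc ENNReal.ofReal (t ^ q)
      = ENNReal.ofReal (b ^ (2 * α / N) / c * I ^ (2 * α / N)) *
          ENNReal.ofReal (c * (t ^ 2 * ρ ^ (-(2 * α)))) := by
        rw [← ENNReal.ofReal_mul (by positivity), hval]
        congr 1
        field_simp
    _ ≤ _ := by gcongr

lemma lintegral_gagKer {w : EN N → ℝ} (hw : Measurable w) :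
    ∫⁻ x, ∫⁻ y, gagKer α w x y = gagSq N α w := by
  rw [gagSq, Measure.volume_eq_prod, lintegral_prod]
  · rfl
  · exact (measurable_gagKer hw).aemeasurable

/-- Deviations from a suitable constant `m` (the mean) are controlled by square averages. -/
lemma exists_mean {B : Set (EN N)} (hBfin : volume B ≠ ⊤) {u : EN N → ℝ}
    (hu : Measurable u) {M : ℝ} (hM : ∀ x, |u x| ≤ M) :
    ∃ m : ℝ, ∀ c : ℝ, ENNReal.ofReal ((c - m) ^ 2) * volume B ≤
      ∫⁻ y in B, ENNReal.ofReal ((c - u y) ^ 2) := by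
  rcases eq_or_ne (volume B) 0 with hB0 | hB0
  · exact ⟨0, fun c => by simp [hB0]⟩
  have hfin : IsFiniteMeasure (volume.restrict B) := ⟨by simpa using hBfin.lt_top⟩
  set μB := (volume B).toReal with hμB
  have hμpos : 0 < μB := ENNReal.toReal_pos hB0 hBfin
  have hint : Integrable u (volume.restrict B) :=
    Integrable.of_bound hu.aestronglyMeasurable M (Eventually.of_forall hM)
  refine ⟨(∫ y in B, u y) / μB, fun c => ?_⟩
  set m := (∫ y in B, u y) / μB with hm
  have hmm : m * μB = ∫ y in B, u y := by rw [hm]; field_simp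
  have hint2 : Integrable (fun y => (c - u y) ^ 2) (volume.restrict B) := by
    refine Integrable.of_bound (by fun_prop) ((|c| + M) ^ 2) (Eventually.of_forall fun y => ?_)
    rw [Real.norm_of_nonneg (sq_nonneg _), ← sq_abs]
    have : |c - u y| ≤ |c| + M := (abs_sub _ _).trans (by gcongr; exact hM y)
    gcongr
  rw [← ofReal_integral_eq_lintegral_ofReal hint2 (Eventually.of_forall fun y => sq_nonneg _),
    ← ENNReal.ofReal_toReal hBfin, ← ENNReal.ofReal_mul (sq_nonneg _)]
  refine ENNReal.ofReal_le_ofReal ?_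
  have hlin : Integrable (fun y => ((c - m) ^ 2 + 2 * (c - m) * m) - 2 * (c - m) * u y)
      (volume.restrict B) := (integrable_const _).sub (hint.const_mul _)
  calc (c - m) ^ 2 * μB
      = ∫ y in B, (((c - m) ^ 2 + 2 * (c - m) * m) - 2 * (c - m) * u y) := by
        rw [integral_sub (integrable_const _) (hint.const_mul _), integral_const,
          integral_const_mul, ← hmm, measureReal_restrict_apply_univ, Measure.real, ← hμB,
          smul_eq_mul]
        ring
    _ ≤ ∫ y in B, (c - u y) ^ 2 :=
        integral_mono hlin hint2 fun y => by
          dsimp only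
          nlinarith [sq_nonneg (m - u y)]

/-- The fractional Sobolev–Poincaré inequality on balls, for bounded functions. -/
lemma exists_sobolev_poincare_ball (hα : 0 < α) (hN : 2 * α < N) :
    ∃ C : ℝ, 0 < C ∧ ∀ (R a M : ℝ) (u : EN N → ℝ), 0 < R → 0 ≤ a → Measurable u →
      (∀ x, |u x| ≤ M) → gagSq N α u ≤ ENNReal.ofReal a →
      ∃ m : ℝ, (∫⁻ y in Metric.ball 0 R, ENNReal.ofReal (|u y - m| ^ critExp N α)) ≤
        ENNReal.ofReal (C * a ^ (critExp N α / 2)) := by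
  obtain ⟨C, hC, hCw⟩ := rpow_le_mul_setLIntegral_gagKer hα hN
  have hNpos : (0 : ℝ) < N := by linarith
  have hq := critExp_gt_two hα hN
  have hqe := critExp_sub_two_div hα hN
  set q := critExp N α with hqdef
  refine ⟨C ^ (q / 2), by positivity, fun R a M u hR ha hu hM hua => ?_⟩
  obtain ⟨m, hm⟩ := exists_mean (measure_ball_lt_top (x := (0 : EN N)) (r := R)).ne hu hM
  refine ⟨m, ?_⟩
  set w : EN N → ℝ := fun y => u y - m with hwdef
  have hw : Measurable w := by fun_prop
  have hwM : ∀ y, |w y| ≤ M + |m| := fun y => (abs_sub _ _).trans (by gcongr; exact hM y)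
  have hfin : (∫⁻ y in Metric.ball 0 R, ENNReal.ofReal (|w y| ^ q)) ≠ ⊤ := by
    refine (setLIntegral_lt_top_of_le_nnreal measure_ball_lt_top.ne
      ⟨((M + |m|) ^ q).toNNReal, fun y _ => ?_⟩).ne
    refine ENNReal.ofReal_le_ofReal ?_
    have := hwM y
    gcongr
  have hI := ENNReal.ofReal_toReal hfin
  set I := (∫⁻ y in Metric.ball 0 R, ENNReal.ofReal (|w y| ^ q)).toReal with hIdef
  rw [← Real.mul_rpow hC.le ha]
  change (∫⁻ y in Metric.ball 0 R, ENNReal.ofReal (|w y| ^ q)) ≤ _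
  rw [← hI]
  rcases (ENNReal.toReal_nonneg : 0 ≤ I).eq_or_lt with h0 | hIpos
  · rw [← hIdef] at h0
    rw [← h0]
    simp
  have hker : ∀ x y, gagKer α w x y = gagKer α u x y := fun x y => by simp [gagKer, hwdef]
  have hpt := hCw R I w hR hIpos hw hI.ge
  have hle : ENNReal.ofReal I ≤ ENNReal.ofReal (C * I ^ (2 * α / N) * a) := by
    rw [hI, ENNReal.ofReal_mul (by positivity)]
    calc (∫⁻ x in Metric.ball 0 R, ENNReal.ofReal (|w x| ^ q))
        ≤ ∫⁻ x in Metric.ball 0 R, ENNReal.ofReal (C * I ^ (2 * α / N)) *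
            ∫⁻ y in Metric.ball 0 R, gagKer α w x y := by
          refine setLIntegral_mono' measurableSet_ball fun x hx => hpt x hx ?_
          refine (hm (u x)).trans (le_of_eq ?_)
          simp [hwdef]
      _ ≤ ∫⁻ x, ENNReal.ofReal (C * I ^ (2 * α / N)) * ∫⁻ y, gagKer α u x y := by
          refine (setLIntegral_le_lintegral _ _).trans (lintegral_mono fun x => ?_)
          dsimp only
          simp_rw [hker]
          gcongr
          exact Measure.restrict_le_self
      _ = ENNReal.ofReal (C * I ^ (2 * α / N)) * gagSq N α u := by
          rw [lintegral_const_mul _ (measurable_gagKer hu).lintegral_prod_right',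
            lintegral_gagKer hu]
      _ ≤ _ := by gcongr
  rw [ENNReal.ofReal_le_ofReal_iff (by positivity)] at hle
  refine ENNReal.ofReal_le_ofReal ?_
  have hpow : I ^ (2 / q) ≤ C * a := by
    have h1 : I ^ (2 / q) = I / I ^ (2 * α / N) := by
      rw [← hqe, ← Real.rpow_one_sub' hIpos.le]
      · congr 1; field_simp; ring
      · have : 0 < 2 / q := by positivity
        have : (q - 2) / q = 1 - 2 / q := by field_simp
        linarith
    rw [h1, div_le_iff₀ (by positivity)]
    linarith
  calc I = (I ^ (2 / q)) ^ (q / 2) := by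
        rw [← Real.rpow_mul hIpos.le, div_mul_div_cancel₀ (by linarith), div_self two_ne_zero,
          Real.rpow_one]
    _ ≤ _ := by gcongr

lemma rpow_mul_le_of_le_add {q X κ κ₁ a J : ℝ} (hq : 2 < q) (hX : 0 ≤ X) (hκ₁ : 0 < κ₁)
    (hκ : κ₁ ≤ κ) (ha : 0 ≤ a) (hJ : 0 ≤ J) (h : X ^ q * κ ≤ J + 4 * X ^ (q - 2) * a) :
    X ^ q * κ ≤ 2 * J + 8 ^ (q / 2) * κ₁ ^ (1 - q / 2) * a ^ (q / 2) := by
  have hκ0 : 0 < κ := hκ₁.trans_le hκ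
  have hp : 0 ≤ X ^ (q - 2) := by positivity
  have hXq : X ^ q = X ^ (q - 2) * X ^ 2 := by
    rw [← Real.rpow_two, ← Real.rpow_add' hX (by linarith)]
    congr 1; ring
  rcases le_or_gt (X ^ 2 * κ) (8 * a) with hc | hc
  · have e1 : X ^ q * κ = (X ^ 2 * κ) ^ (q / 2) * κ ^ (1 - q / 2) := by
      rw [Real.mul_rpow (by positivity) hκ0.le, mul_assoc, ← Real.rpow_add hκ0, ← Real.rpow_two,
        ← Real.rpow_mul hX, mul_div_cancel₀ _ two_ne_zero]
      simp
    have e2 : κ ^ (1 - q / 2) ≤ κ₁ ^ (1 - q / 2) :=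
      Real.rpow_le_rpow_of_nonpos hκ₁ hκ (by linarith)
    have e3 : (X ^ 2 * κ) ^ (q / 2) ≤ 8 ^ (q / 2) * a ^ (q / 2) := by
      rw [← Real.mul_rpow (by norm_num) ha]
      gcongr
    calc X ^ q * κ ≤ (8 ^ (q / 2) * a ^ (q / 2)) * κ₁ ^ (1 - q / 2) := by
          rw [e1]; gcongr
      _ ≤ _ := by linarith
  · have h1 : X ^ (q - 2) * (8 * a) ≤ X ^ (q - 2) * (X ^ 2 * κ) := by gcongr
    have h2 : 0 ≤ 8 ^ (q / 2) * κ₁ ^ (1 - q / 2) * a ^ (q / 2) := by positivity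
    rw [hXq] at h ⊢
    nlinarith

lemma rpow_abs_le_of_sub {q m y : ℝ} (hq : 2 < q) :
    |m| ^ q ≤ 2 ^ q * |y - m| ^ q + 4 * |m| ^ (q - 2) * y ^ 2 := by
  rcases le_or_gt |m| (2 * |y - m|) with h | h
  · have h1 : |m| ^ q ≤ (2 * |y - m|) ^ q := by gcongr
    rw [Real.mul_rpow two_pos.le (abs_nonneg _)] at h1
    have : 0 ≤ 4 * |m| ^ (q - 2) * y ^ 2 := by positivity
    linarith
  · have h1 : |m| ≤ 2 * |y| := by
      have := abs_sub_abs_le_abs_sub m y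
      rw [abs_sub_comm] at this
      linarith
    have h2 : |m| ^ q = |m| ^ (q - 2) * |m| ^ 2 := by
      rw [← Real.rpow_two, ← Real.rpow_add' (abs_nonneg _) (by linarith)]
      congr 1; ring
    have h3 : |m| ^ 2 ≤ 4 * y ^ 2 := by
      have : |m| ^ 2 ≤ (2 * |y|) ^ 2 := by gcongr
      rwa [mul_pow, sq_abs y, show (2 : ℝ) ^ 2 = 4 by norm_num] at this
    have h4 : 0 ≤ 2 ^ q * |y - m| ^ q := by positivity
    have h5 : |m| ^ (q - 2) * |m| ^ 2 ≤ |m| ^ (q - 2) * (4 * y ^ 2) := by gcongr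
    rw [h2]
    linarith

lemma rpow_abs_le_two_rpow_mul {q m y : ℝ} (hq : 2 < q) :
    |y| ^ q ≤ 2 ^ q * (|m| ^ q + |y - m| ^ q) := by
  have h0 : |y| ≤ |m| + |y - m| := by
    have := abs_add_le m (y - m)
    rwa [add_sub_cancel] at this
  have hm : 0 ≤ |m| ^ q := by positivity
  have hy : 0 ≤ |y - m| ^ q := by positivity
  have h2 : (0 : ℝ) < 2 ^ q := by positivity
  rcases le_total |m| |y - m| with h | h
  · have : |y| ^ q ≤ (2 * |y - m|) ^ q := by gcongr; linarith
    rw [Real.mul_rpow two_pos.le (abs_nonneg _)] at this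
    nlinarith
  · have : |y| ^ q ≤ (2 * |m|) ^ q := by gcongr; linarith
    rw [Real.mul_rpow two_pos.le (abs_nonneg _)] at this
    nlinarith

/-- A weighted critical Sobolev estimate on large balls, for bounded functions. -/
lemma exists_weighted_sobolev_ball (hα : 0 < α) (hN : 2 * α < N) {K : EN N → ℝ}
    (hK : Continuous K) (hKpos : ∀ x, 0 < K x) {CK : ℝ} (hKle : ∀ x, K x ≤ CK) :
    ∃ C : ℝ, 0 < C ∧ ∀ (R a M : ℝ) (u : EN N → ℝ), 1 ≤ R → 0 ≤ a → Measurable u →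
      (∀ x, |u x| ≤ M) → gagSq N α u ≤ ENNReal.ofReal a →
      (∫⁻ x, ENNReal.ofReal (K x * u x ^ 2)) ≤ ENNReal.ofReal a →
      (∫⁻ y in Metric.ball 0 R, ENNReal.ofReal (K y * |u y| ^ critExp N α)) ≤
        ENNReal.ofReal (C * a ^ (critExp N α / 2)) := by
  obtain ⟨C, hC, hCu⟩ := exists_sobolev_poincare_ball (N := N) hα hN
  have hq := critExp_gt_two hα hN
  set q := critExp N α with hqdef
  have hCK : 0 < CK := (hKpos 0).trans_le (hKle 0)
  have hKfin : ∀ R : ℝ, (∫⁻ y in Metric.ball (0 : EN N) R, ENNReal.ofReal (K y)) ≠ ⊤ := fun R =>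
    (setLIntegral_lt_top_of_le_nnreal measure_ball_lt_top.ne
      ⟨CK.toNNReal, fun y _ => ENNReal.ofReal_le_ofReal (hKle y)⟩).ne
  set κ : ℝ → ℝ := fun R => (∫⁻ y in Metric.ball (0 : EN N) R, ENNReal.ofReal (K y)).toReal
    with hκdef
  have hκ₁ : 0 < κ 1 := by
    refine ENNReal.toReal_pos (ne_of_gt ?_) (hKfin 1)
    rw [setLIntegral_pos_iff (by fun_prop)]
    have : Function.support (fun y => ENNReal.ofReal (K y)) = Set.univ := by
      ext y
      simpa using hKpos y
    rw [this, Set.univ_inter]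
    exact Metric.measure_ball_pos _ _ one_pos
  set E : ℝ := 2 * (2 ^ q * CK * C) + 8 ^ (q / 2) * κ 1 ^ (1 - q / 2) with hE
  have hEpos : 0 < E := by positivity
  refine ⟨2 ^ q * (E + CK * C), by positivity, fun R a M u hR ha hu hM hua hKu => ?_⟩
  obtain ⟨m, hm⟩ := hCu R a M u (by linarith) ha hu hM hua
  have hκR : κ 1 ≤ κ R :=
    ENNReal.toReal_mono (hKfin R) (lintegral_mono_set (Metric.ball_subset_ball hR))
  have hκR' : ENNReal.ofReal (κ R) = ∫⁻ y in Metric.ball (0 : EN N) R, ENNReal.ofReal (K y) :=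
    ENNReal.ofReal_toReal (hKfin R)
  have hmean : ENNReal.ofReal (|m| ^ q * κ R) ≤
      ENNReal.ofReal (2 ^ q * CK * C * a ^ (q / 2) + 4 * |m| ^ (q - 2) * a) := by
    calc ENNReal.ofReal (|m| ^ q * κ R)
        = ∫⁻ y in Metric.ball (0 : EN N) R, ENNReal.ofReal (|m| ^ q) * ENNReal.ofReal (K y) := by
          rw [ENNReal.ofReal_mul (by positivity), hκR', lintegral_const_mul _ (by fun_prop)]
      _ ≤ ∫⁻ y in Metric.ball (0 : EN N) R,
            (ENNReal.ofReal (2 ^ q * CK) * ENNReal.ofReal (|u y - m| ^ q) +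
              ENNReal.ofReal (4 * |m| ^ (q - 2)) * ENNReal.ofReal (K y * u y ^ 2)) := by
          refine lintegral_mono fun y => ?_
          have hy := (hKpos y).le
          dsimp only
          rw [← ENNReal.ofReal_mul (by positivity), ← ENNReal.ofReal_mul (by positivity),
            ← ENNReal.ofReal_mul (by positivity), ← ENNReal.ofReal_add (by positivity)
              (by positivity)]
          refine ENNReal.ofReal_le_ofReal ?_
          calc |m| ^ q * K y
              ≤ (2 ^ q * |u y - m| ^ q + 4 * |m| ^ (q - 2) * u y ^ 2) * K y := by
                gcongr; exact rpow_abs_le_of_sub hq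
            _ = 2 ^ q * |u y - m| ^ q * K y + 4 * |m| ^ (q - 2) * (K y * u y ^ 2) := by ring
            _ ≤ 2 ^ q * |u y - m| ^ q * CK + 4 * |m| ^ (q - 2) * (K y * u y ^ 2) := by
                gcongr; exact hKle y
            _ = _ := by ring
      _ ≤ ENNReal.ofReal (2 ^ q * CK) * ENNReal.ofReal (C * a ^ (q / 2)) +
            ENNReal.ofReal (4 * |m| ^ (q - 2)) * ENNReal.ofReal a := by
          rw [lintegral_add_left (by fun_prop), lintegral_const_mul _ (by fun_prop),
            lintegral_const_mul _ (by fun_prop)]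
          gcongr
          exact (setLIntegral_le_lintegral _ _).trans hKu
      _ = _ := by
          rw [← ENNReal.ofReal_mul (by positivity), ← ENNReal.ofReal_mul (by positivity),
            ← ENNReal.ofReal_add (by positivity) (by positivity)]
          congr 1; ring
  rw [ENNReal.ofReal_le_ofReal_iff (by positivity)] at hmean
  have hmean' := rpow_mul_le_of_le_add hq (abs_nonneg m) hκ₁ hκR ha (by positivity) hmean
  calc (∫⁻ y in Metric.ball 0 R, ENNReal.ofReal (K y * |u y| ^ q))
      ≤ ∫⁻ y in Metric.ball (0 : EN N) R,
          (ENNReal.ofReal (2 ^ q * |m| ^ q) * ENNReal.ofReal (K y) +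
            ENNReal.ofReal (2 ^ q * CK) * ENNReal.ofReal (|u y - m| ^ q)) := by
        refine lintegral_mono fun y => ?_
        have hy := (hKpos y).le
        dsimp only
        rw [← ENNReal.ofReal_mul (by positivity), ← ENNReal.ofReal_mul (by positivity),
          ← ENNReal.ofReal_add (by positivity) (by positivity)]
        refine ENNReal.ofReal_le_ofReal ?_
        calc K y * |u y| ^ q ≤ K y * (2 ^ q * (|m| ^ q + |u y - m| ^ q)) := by
              gcongr; exact rpow_abs_le_two_rpow_mul hq
          _ = 2 ^ q * |m| ^ q * K y + 2 ^ q * K y * |u y - m| ^ q := by ring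
          _ ≤ _ := by gcongr; exact hKle y
    _ ≤ ENNReal.ofReal (2 ^ q * |m| ^ q) * ENNReal.ofReal (κ R) +
          ENNReal.ofReal (2 ^ q * CK) * ENNReal.ofReal (C * a ^ (q / 2)) := by
        rw [lintegral_add_left (by fun_prop), lintegral_const_mul _ (by fun_prop),
          lintegral_const_mul _ (by fun_prop), hκR']
        gcongr
    _ ≤ _ := by
        have hκ0 : 0 ≤ κ R := hκ₁.le.trans hκR
        rw [← ENNReal.ofReal_mul (by positivity), ← ENNReal.ofReal_mul (by positivity),
          ← ENNReal.ofReal_add (by positivity) (by positivity)]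
        refine ENNReal.ofReal_le_ofReal ?_
        have h2 : (0 : ℝ) < 2 ^ q := by positivity
        calc 2 ^ q * |m| ^ q * κ R + 2 ^ q * CK * (C * a ^ (q / 2))
            = 2 ^ q * (|m| ^ q * κ R + CK * C * a ^ (q / 2)) := by ring
          _ ≤ 2 ^ q * ((2 * (2 ^ q * CK * C * a ^ (q / 2)) +
                8 ^ (q / 2) * κ 1 ^ (1 - q / 2) * a ^ (q / 2)) + CK * C * a ^ (q / 2)) := by
              gcongr
          _ = _ := by rw [hE]; ring

/-- The weighted critical Sobolev estimate on the whole space. -/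
lemma exists_weighted_sobolev (hα : 0 < α) (hN : 2 * α < N) {K : EN N → ℝ}
    (hK : Continuous K) (hKpos : ∀ x, 0 < K x) {CK : ℝ} (hKle : ∀ x, K x ≤ CK) :
    ∃ C : ℝ, 0 < C ∧ ∀ (a : ℝ) (u : EN N → ℝ), 0 ≤ a → Measurable u →
      gagSq N α u ≤ ENNReal.ofReal a →
      (∫⁻ x, ENNReal.ofReal (K x * u x ^ 2)) ≤ ENNReal.ofReal a →
      (∫⁻ y, ENNReal.ofReal (K y * |u y| ^ critExp N α)) ≤
        ENNReal.ofReal (C * a ^ (critExp N α / 2)) := by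
  obtain ⟨C, hC, hCu⟩ := exists_weighted_sobolev_ball hα hN hK hKpos hKle
  refine ⟨C, hC, fun a u ha hu hua hKu => ?_⟩
  set T : ℕ → ℝ → ℝ := fun n t => max (-n) (min t n) with hT
  have hTm : ∀ n, Measurable (T n) := fun n => by fun_prop
  have hTabs : ∀ n t, |T n t| ≤ n := fun n t => by
    rw [abs_le]
    exact ⟨le_max_left _ _, max_le (by linarith [n.cast_nonneg (α := ℝ)]) (min_le_right _ _)⟩
  have hTlip : ∀ n s t, |T n s - T n t| ≤ |s - t| := fun n s t =>
    (abs_max_sub_max_le_max _ _ _ _).trans <| by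
      rw [sub_self, abs_zero, max_eq_right (abs_nonneg _)]
      refine (abs_min_sub_min_le_max _ _ _ _).trans ?_
      simp
  have hTzero : ∀ n, T n 0 = 0 := fun n => by simp [hT]
  have hTeq : ∀ (n : ℕ) (t : ℝ), |t| ≤ n → T n t = t := fun n t h => by
    have := abs_le.1 h
    simp only [hT]
    rw [min_eq_left this.2, max_eq_right this.1]
  set h : ℕ → EN N → ENNReal := fun n => (Metric.ball (0 : EN N) (n + 1)).indicator
    fun y => ENNReal.ofReal (K y * |T n (u y)| ^ critExp N α) with hh
  have hhm : ∀ n, Measurable (h n) := fun n =>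
    Measurable.indicator (by have := hTm n; fun_prop) measurableSet_ball
  have hbound : ∀ n, ∫⁻ y, h n y ≤ ENNReal.ofReal (C * a ^ (critExp N α / 2)) := fun n => by
    rw [lintegral_indicator measurableSet_ball]
    refine hCu (n + 1) a n (fun y => T n (u y)) (by simp) ha ((hTm n).comp hu)
      (fun x => hTabs n _) (le_trans (lintegral_mono fun p => ?_) hua)
      (le_trans (lintegral_mono fun x => ?_) hKu)
    · refine ENNReal.ofReal_le_ofReal ?_
      have := sq_le_sq.2 (hTlip n (u p.1) (u p.2))
      gcongr
    · refine ENNReal.ofReal_le_ofReal ?_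
      have h1 := hTlip n (u x) 0
      rw [hTzero, sub_zero, sub_zero] at h1
      have := sq_le_sq.2 h1
      have := (hKpos x).le
      gcongr
  have hlim : ∀ y, liminf (fun n => h n y) atTop =
      ENNReal.ofReal (K y * |u y| ^ critExp N α) := fun y => by
    refine Tendsto.liminf_eq (tendsto_const_nhds.congr' ?_)
    obtain ⟨k, hk⟩ := exists_nat_ge (max ‖y‖ |u y|)
    filter_upwards [eventually_ge_atTop k] with n hn
    have hkn : (k : ℝ) ≤ n := by exact_mod_cast hn
    have hy : y ∈ Metric.ball (0 : EN N) (n + 1) := by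
      rw [mem_ball_zero_iff]
      linarith [le_max_left ‖y‖ |u y|]
    simp only [hh, Set.indicator_of_mem hy]
    rw [hTeq n _ (by linarith [le_max_right ‖y‖ |u y|])]
  calc (∫⁻ y, ENNReal.ofReal (K y * |u y| ^ critExp N α))
      = ∫⁻ y, liminf (fun n => h n y) atTop := by simp_rw [hlim]
    _ ≤ liminf (fun n => ∫⁻ y, h n y) atTop := lintegral_liminf_le hhm
    _ ≤ _ := liminf_le_of_le (by isBoundedDefault) fun b hb => by
        obtain ⟨n, hn⟩ := hb.exists
        exact hn.trans (hbound n)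

lemma exists_growth_bound {f : ℝ → ℝ} (hf : Continuous f) (hf1 : Cf1 f) {q : ℝ} (hq : 2 < q)
    (hf2 : Cf2 f q) {ε : ℝ} (hε : 0 < ε) :
    ∃ C : ℝ, 0 < C ∧ ∀ t, f t * t ≤ ε * t ^ 2 + C * |t| ^ q := by
  have hsmall := (Metric.tendsto_nhds.1 hf1 ε hε)
  rw [eventually_nhdsWithin_iff, Metric.eventually_nhds_iff] at hsmall
  obtain ⟨δ, hδ, hsmall⟩ := hsmall
  have hlarge := (Metric.tendsto_nhds.1 hf2 1 one_pos)
  rw [eventually_comap, eventually_atTop] at hlarge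
  obtain ⟨T, hlarge⟩ := hlarge
  obtain ⟨M, hM⟩ := (isCompact_Icc (a := -T) (b := T)).exists_bound_of_continuousOn
    hf.continuousOn
  have hδq : 0 < δ ^ (q - 1) := by positivity
  refine ⟨max 1 (M / δ ^ (q - 1)), by positivity, fun t => ?_⟩
  set C := max 1 (M / δ ^ (q - 1)) with hC
  have hC1 : 1 ≤ C := le_max_left _ _
  rcases eq_or_ne t 0 with rfl | ht
  · rw [abs_zero, Real.zero_rpow (by linarith)]
    simp
  have htpos : 0 < |t| := abs_pos.2 ht
  have hsplit : |t| ^ q = |t| ^ (q - 1) * |t| := by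
    rw [← Real.rpow_add_one htpos.ne']
    congr 1; ring
  have hft : f t * t ≤ |f t| * |t| := by
    rw [← abs_mul]; exact le_abs_self _
  have hCq : 0 ≤ C * |t| ^ q := by positivity
  have hεt : 0 ≤ ε * t ^ 2 := by positivity
  rcases lt_or_ge |t| δ with h1 | h1
  · have h := @hsmall t (by simpa using h1) ht
    rw [dist_zero_right, Real.norm_eq_abs, abs_div, abs_abs, div_lt_iff₀ htpos] at h
    have : |f t| * |t| ≤ ε * |t| * |t| := by gcongr
    rw [mul_assoc, abs_mul_abs_self, ← sq] at this
    linarith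
  have hbase : |f t| ≤ C * |t| ^ (q - 1) := by
    rcases le_or_gt T |t| with h2 | h2
    · have h := hlarge |t| h2 t rfl
      rw [dist_zero_right, Real.norm_eq_abs, abs_div, div_lt_iff₀ (by positivity),
        abs_of_nonneg (by positivity : 0 ≤ |t| ^ (q - 1)), one_mul] at h
      have : 0 ≤ |t| ^ (q - 1) := by positivity
      nlinarith
    · have h := hM t (abs_le.1 h2.le)
      rw [Real.norm_eq_abs] at h
      have h3 : M / δ ^ (q - 1) ≤ C := le_max_right _ _
      rw [div_le_iff₀ hδq] at h3
      have h4 : δ ^ (q - 1) ≤ |t| ^ (q - 1) :=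
        Real.rpow_le_rpow hδ.le h1 (by linarith)
      have : C * δ ^ (q - 1) ≤ C * |t| ^ (q - 1) := by gcongr
      linarith
  have : |f t| * |t| ≤ C * |t| ^ (q - 1) * |t| := by gcongr
  rw [mul_assoc, ← hsplit] at this
  linarith

/-- A part `φ` of `v` with nonnegative interaction with the rest of `v`, such as `v⁺` or `v⁻`. -/
structure IsPart (v φ : EN N → ℝ) : Prop where
  measurable : Measurable φ
  eq_zero_or : ∀ x, φ x = 0 ∨ φ x = v x
  sq_le_mul : ∀ x y, (φ x - φ y) ^ 2 ≤ (v x - v y) * (φ x - φ y)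
  mul_le_sq : ∀ x y, (v x - v y) * (φ x - φ y) ≤ (v x - v y) ^ 2

lemma isPart_uplus {v : EN N → ℝ} (hv : Measurable v) : IsPart v (uplus v) where
  measurable := by unfold uplus; fun_prop
  eq_zero_or x := (max_choice (v x) 0).symm
  sq_le_mul x y := by
    unfold uplus
    rcases max_cases (v x) 0 with h | h <;> rcases max_cases (v y) 0 with h' | h' <;>
      rw [h.1, h'.1] <;> nlinarith
  mul_le_sq x y := by
    unfold uplus
    rcases max_cases (v x) 0 with h | h <;> rcases max_cases (v y) 0 with h' | h' <;>
      rw [h.1, h'.1] <;> nlinarith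

lemma isPart_uminus {v : EN N → ℝ} (hv : Measurable v) : IsPart v (uminus v) where
  measurable := by unfold uminus; fun_prop
  eq_zero_or x := (min_choice (v x) 0).symm
  sq_le_mul x y := by
    unfold uminus
    rcases min_cases (v x) 0 with h | h <;> rcases min_cases (v y) 0 with h' | h' <;>
      rw [h.1, h'.1] <;> nlinarith
  mul_le_sq x y := by
    unfold uminus
    rcases min_cases (v x) 0 with h | h <;> rcases min_cases (v y) 0 with h' | h' <;>
      rw [h.1, h'.1] <;> nlinarith

lemma integrable_of_lintegral_ofReal_ne_top {β : Type*} [MeasurableSpace β] {μ : Measure β}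
    {g : β → ℝ} (hg : Measurable g) (h0 : ∀ x, 0 ≤ g x)
    (h : ∫⁻ x, ENNReal.ofReal (g x) ∂μ ≠ ⊤) : Integrable g μ :=
  (lintegral_ofReal_ne_top_iff_integrable hg.aestronglyMeasurable
    (Eventually.of_forall h0)).1 h

section Part

variable {V K : EN N → ℝ} {v φ : EN N → ℝ}

lemma IsPart.normSq_lt_top (hV : ∀ x, 0 < V x) (hv : memX α V v) (h : IsPart v φ) :
    normSq α V φ < ⊤ := by
  refine lt_of_le_of_lt (add_le_add (lintegral_mono fun p => ?_) (lintegral_mono fun x => ?_)) hv.2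
  · refine ENNReal.ofReal_le_ofReal ?_
    have := (h.sq_le_mul p.1 p.2).trans (h.mul_le_sq p.1 p.2)
    gcongr
  · refine ENNReal.ofReal_le_ofReal ?_
    have := hV x
    rcases h.eq_zero_or x with h0 | h0 <;> rw [h0]
    simp only [ne_eq, OfNat.ofNat_ne_zero, not_false_eq_true, zero_pow, mul_zero]
    positivity

/-- Testing `J'(v)` against a part of `v` controls the norm of that part. -/
lemma IsPart.toReal_normSq_le (hV : Continuous V) (hVpos : ∀ x, 0 < V x) (hv : memX α V v)
    (h : IsPart v φ) {f : ℝ → ℝ} (hJ : Jd α V K f v φ = 0) :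
    (normSq α V φ).toReal ≤ ∫ x, K x * f (v x) * φ x := by
  have hvm := hv.1
  have hφm := h.measurable
  have hfin := ENNReal.add_lt_top.1 (h.normSq_lt_top hVpos hv)
  have hvfin := ENNReal.add_lt_top.1 hv.2
  have hVint : (∫ x, V x * v x * φ x) = (∫⁻ x, ENNReal.ofReal (V x * φ x ^ 2)).toReal := by
    rw [← integral_eq_lintegral_of_nonneg_ae
      (Eventually.of_forall fun x => mul_nonneg (hVpos x).le (sq_nonneg _)) (by fun_prop)]
    congr 1
    ext x
    rcases h.eq_zero_or x with h0 | h0 <;> rw [h0] <;> ring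
  have hgag : (gagSq N α φ).toReal ≤
      ∫ p : EN N × EN N, (v p.1 - v p.2) * (φ p.1 - φ p.2) /
        ‖p.1 - p.2‖ ^ ((N : ℝ) + 2 * α) := by
    rw [gagSq, ← integral_eq_lintegral_of_nonneg_ae
      (Eventually.of_forall fun p => by dsimp; positivity)
      (Measurable.aestronglyMeasurable (by fun_prop))]
    have hvi : Integrable fun p : EN N × EN N =>
        (v p.1 - v p.2) ^ 2 / ‖p.1 - p.2‖ ^ ((N : ℝ) + 2 * α) :=
      integrable_of_lintegral_ofReal_ne_top (by fun_prop) (fun p => by positivity) hvfin.1.ne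
    have hmid : ∀ p : EN N × EN N, 0 ≤ (v p.1 - v p.2) * (φ p.1 - φ p.2) := fun p =>
      (sq_nonneg _).trans (h.sq_le_mul p.1 p.2)
    refine integral_mono (integrable_of_lintegral_ofReal_ne_top (by fun_prop)
      (fun p => by positivity) hfin.1.ne) (hvi.mono'
        (Measurable.aestronglyMeasurable (by fun_prop)) ?_) fun p => ?_
    · refine Eventually.of_forall fun p => ?_
      have := hmid p
      rw [Real.norm_of_nonneg (by positivity)]
      have := h.mul_le_sq p.1 p.2
      gcongr
    · have := h.sq_le_mul p.1 p.2
      dsimp only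
      gcongr
  rw [Jd, hVint] at hJ
  rw [normSq, ENNReal.toReal_add hfin.1.ne hfin.2.ne]
  linarith

lemma toReal_normSq_pos (hV : Continuous V) (hVpos : ∀ x, 0 < V x) (hφ : Measurable φ)
    (hfin : normSq α V φ < ⊤) (h0 : NotAEZero φ) : 0 < (normSq α V φ).toReal := by
  refine ENNReal.toReal_pos (fun hz => h0 ?_) hfin.ne
  have h1 : ∫⁻ x, ENNReal.ofReal (V x * φ x ^ 2) = 0 := (add_eq_zero.1 hz).2
  rw [lintegral_eq_zero_iff (by fun_prop)] at h1
  filter_upwards [h1] with x hx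
  have h2 : V x * φ x ^ 2 ≤ 0 := by simpa using hx
  have h3 := hVpos x
  have h4 : φ x ^ 2 = 0 := le_antisymm (by by_contra! h; nlinarith) (sq_nonneg _)
  simpa using h4

end Part

lemma exists_Xnorm_lower_bound (hα : 0 < α) (hN : 2 * α < N) {V K : EN N → ℝ} {f : ℝ → ℝ}
    (hV : Continuous V) (hK : Continuous K) (hf : Continuous f) (h1 : H1 V K) (h3 : H3 V K)
    (hf1 : Cf1 f) (hf2 : Cf2 f (critExp N α)) :
    ∃ β : ℝ, 0 < β ∧ ∀ v φ : EN N → ℝ, memX α V v → IsPart v φ → NotAEZero φ →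
      Jd α V K f v φ = 0 → β ≤ Xnorm α V φ := by
  obtain ⟨hVpos, hKpos, CK, hKle⟩ := h1
  obtain ⟨C₀, hC₀⟩ := h3
  obtain ⟨S, hS, hSob⟩ := exists_weighted_sobolev hα hN hK hKpos hKle
  have hq := critExp_gt_two hα hN
  set q := critExp N α with hqdef
  set D := max C₀ 1 with hD
  have hD1 : 1 ≤ D := le_max_right _ _
  have hD0 : 0 < D := by linarith
  have hKV : ∀ x, K x ≤ D * V x := fun x => by
    have := (hC₀ x).trans (le_max_left C₀ 1)
    rwa [div_le_iff₀ (hVpos x)] at this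
  obtain ⟨C, hC, hgrow⟩ := exists_growth_bound hf hf1 hq hf2 (ε := 1 / (2 * D)) (by positivity)
  set E := C * (S * D ^ (q / 2)) with hE
  have hEpos : 0 < E := by positivity
  set b := (1 / (2 * E)) ^ (1 / (q / 2 - 1)) with hb
  have hbpos : 0 < b := by positivity
  refine ⟨b ^ (1 / 2 : ℝ), by positivity, fun v φ hv hφ hne hJ => ?_⟩
  have hφm := hφ.measurable
  have hvm := hv.1
  have hfin := hφ.normSq_lt_top hVpos hv
  have hle := hφ.toReal_normSq_le hV hVpos hv hJ
  have hpos := toReal_normSq_pos hV hVpos hφm hfin hne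
  have hofReal := ENNReal.ofReal_toReal hfin.ne
  rw [Xnorm]
  set a := (normSq α V φ).toReal with ha
  have hKφ : (∫⁻ x, ENNReal.ofReal (K x * φ x ^ 2)) ≤ ENNReal.ofReal (D * a) := by
    rw [ENNReal.ofReal_mul hD0.le, hofReal]
    calc (∫⁻ x, ENNReal.ofReal (K x * φ x ^ 2))
        ≤ ∫⁻ x, ENNReal.ofReal D * ENNReal.ofReal (V x * φ x ^ 2) := by
          refine lintegral_mono fun x => ?_
          dsimp only
          rw [← ENNReal.ofReal_mul hD0.le, ← mul_assoc]
          have := hKV x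
          gcongr
      _ = ENNReal.ofReal D * ∫⁻ x, ENNReal.ofReal (V x * φ x ^ 2) :=
          lintegral_const_mul _ (by fun_prop)
      _ ≤ _ := by gcongr; exact le_add_self
  have hgag : gagSq N α φ ≤ ENNReal.ofReal (D * a) := by
    calc gagSq N α φ ≤ normSq α V φ := le_self_add
      _ = ENNReal.ofReal a := hofReal.symm
      _ ≤ _ := ENNReal.ofReal_le_ofReal (by nlinarith)
  have hKq := hSob (D * a) φ (by positivity) hφm hgag hKφ
  have hint2 : Integrable fun x => K x * φ x ^ 2 :=
    integrable_of_lintegral_ofReal_ne_top (by fun_prop)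
      (fun x => mul_nonneg (hKpos x).le (sq_nonneg _)) (hKφ.trans_lt ENNReal.ofReal_lt_top).ne
  have hintq : Integrable fun x => K x * |φ x| ^ q :=
    integrable_of_lintegral_ofReal_ne_top (by fun_prop)
      (fun x => mul_nonneg (hKpos x).le (by positivity)) (hKq.trans_lt ENNReal.ofReal_lt_top).ne
  have hI2 : ∫ x, K x * φ x ^ 2 ≤ D * a := by
    rw [← ENNReal.ofReal_le_ofReal_iff (by positivity), ofReal_integral_eq_lintegral_ofReal hint2
      (Eventually.of_forall fun x => mul_nonneg (hKpos x).le (sq_nonneg _))]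
    exact hKφ
  have hIq : ∫ x, K x * |φ x| ^ q ≤ S * (D * a) ^ (q / 2) := by
    rw [← ENNReal.ofReal_le_ofReal_iff (by positivity), ofReal_integral_eq_lintegral_ofReal hintq
      (Eventually.of_forall fun x => mul_nonneg (hKpos x).le (by positivity))]
    exact hKq
  have hpt : ∀ x, K x * f (v x) * φ x ≤
      1 / (2 * D) * (K x * φ x ^ 2) + C * (K x * |φ x| ^ q) := fun x => by
    have hx := hKpos x
    rcases hφ.eq_zero_or x with h0 | h0
    · rw [h0, mul_zero]
      positivity
    · have := mul_le_mul_of_nonneg_left (hgrow (φ x)) hx.le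
      rw [← h0]
      linarith
  have hsum := (hint2.const_mul (1 / (2 * D))).add (hintq.const_mul C)
  have hmain : ∫ x, K x * f (v x) * φ x ≤
      1 / (2 * D) * (∫ x, K x * φ x ^ 2) + C * ∫ x, K x * |φ x| ^ q := by
    rw [← integral_const_mul, ← integral_const_mul,
      ← integral_add (hint2.const_mul _) (hintq.const_mul _)]
    by_cases hi : Integrable fun x => K x * f (v x) * φ x
    · exact integral_mono hi hsum hpt
    · rw [integral_undef hi]
      refine integral_nonneg fun x => ?_
      have hx := hKpos x
      dsimp only [Pi.zero_apply]
      positivity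
  have hfinal : a ≤ a / 2 + E * a ^ (q / 2) := by
    calc a ≤ 1 / (2 * D) * (D * a) + C * (S * (D * a) ^ (q / 2)) :=
          hle.trans (hmain.trans (by gcongr))
      _ = _ := by
          rw [Real.mul_rpow hD0.le hpos.le, hE]
          field_simp
  have hba : b ≤ a := by
    have hsplit : a ^ (q / 2) = a * a ^ (q / 2 - 1) := by
      rw [Real.rpow_sub_one hpos.ne']
      field_simp
    have hlow : 1 / (2 * E) ≤ a ^ (q / 2 - 1) := by
      rw [div_le_iff₀ (by positivity)]
      rw [hsplit] at hfinal
      by_contra! hcon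
      nlinarith
    calc b ≤ (a ^ (q / 2 - 1)) ^ (1 / (q / 2 - 1)) := by
          have : 0 < q / 2 - 1 := by linarith
          rw [hb]
          gcongr
      _ = a := by
          rw [← Real.rpow_mul hpos.le, mul_one_div_cancel (by linarith), Real.rpow_one]
  gcongr

end ZeroMass

open ZeroMass
/-- Estimate (4.9): uniform lower bound on the nodal set, `‖v^±‖ ≥ β` on `M`. -/
theorem statement18 {N : ℕ} (α : ℝ) (hα : α ∈ Set.Ioo (0 : ℝ) 1) (hN : 2 * α < N)
    (V K : EN N → ℝ) (f : ℝ → ℝ)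
    (hV : Continuous V) (hK : Continuous K) (hf : Continuous f)
    (h1 : H1 V K) (h2 : H2 K) (h3 : H3 V K)
    (hf1 : Cf1 f) (hf2 : Cf2 f (critExp N α)) :
    ∃ β : ℝ, 0 < β ∧ ∀ v : EN N → ℝ, memM α V K f v →
      β ≤ Xnorm α V (uplus v) ∧ β ≤ Xnorm α V (uminus v) := by
  obtain ⟨β, hβ, h⟩ := exists_Xnorm_lower_bound hα.1 hN hV hK hf h1 h3 hf1 hf2
  refine ⟨β, hβ, fun v hv => ?_⟩
  obtain ⟨⟨hvX, -, -⟩, hp, hm, hJp, hJm⟩ := hv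
  exact ⟨h v _ hvX (isPart_uplus hvX.1) hp hJp, h v _ hvX (isPart_uminus hvX.1) hm hJm⟩
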